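/- Let 0<α<1, a∈ℝ, h>0, and let τ₃, τ₄ : [0,h] → ℝ be Hölder continuous (the paper's class CVL(0,h)). Define w₃(x,t)=∫₀^t ∂²_x G_α^{2α/3}(x−a,t−η)τ₃(η)dη for x≠a and w₄(x,t)=∫₀^t ∂²_x V_α^{2α/3}(x−a,t−η)τ₄(η)dη for x>a. Then for every 0<t<h: lim_{x→a⁻} w₃(x,t) = (1/3)τ₃(t); lim_{x→a⁺} w₃(x,t) = −(2/3)τ₃(t); and lim_{x→a⁺} w₄(x,t) = 0. -/

import Mathlib

open MeasureTheory Real Filter Set Topology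

/-- Caputo fractional derivative of order `α` with base point `0`. -/
noncomputable def caputoD (α : ℝ) (g : ℝ → ℝ) (t : ℝ) : ℝ :=
  (1 / Real.Gamma (1 - α)) * ∫ ξ in (0:ℝ)..t, deriv g ξ / (t - ξ) ^ α

/-- Riemann–Liouville fractional integral of order `β` with base point `0`. -/
noncomputable def fracJ (β : ℝ) (g : ℝ → ℝ) (t : ℝ) : ℝ :=
  (1 / Real.Gamma β) * ∫ ξ in (0:ℝ)..t, g ξ * (t - ξ) ^ (β - 1)

/-- The Wright function `φ(λ, μ; z)`. -/
noncomputable def wrightPhi (l μ z : ℂ) : ℂ :=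
  ∑' n : ℕ, z ^ n / ((n.factorial : ℂ) * Complex.Gamma (l * n + μ))

/-- The cube root of unity `e^{2πi/3}`. -/
noncomputable def e23 : ℂ := Complex.exp (2 * Real.pi * Complex.I / 3)

/-- First fundamental solution `G_α^μ(x,t)` of the time-fractional Airy equation. -/
noncomputable def Gfun (α μ : ℝ) (x t : ℝ) : ℝ :=
  if x < 0 then
    (1/3) * t ^ (μ - 1) * (wrightPhi (-(α/3)) μ ((x / t ^ (α/3) : ℝ) : ℂ)).re
  else
    -(2/3) * t ^ (μ - 1) * (e23 * wrightPhi (-(α/3)) μ (e23 * ((x / t ^ (α/3) : ℝ) : ℂ))).re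

/-- Second fundamental solution `V_α^μ(x,t)` of the time-fractional Airy equation. -/
noncomputable def Vfun (α μ : ℝ) (x t : ℝ) : ℝ :=
  (1/3) * t ^ (μ - 1) * (e23 * wrightPhi (-(α/3)) μ (e23 * ((x / t ^ (α/3) : ℝ) : ℂ))).im

/-- `G_α^μ` extended across `x = 0` by its common one-sided limit. -/
noncomputable def Ghat (α μ : ℝ) (x t : ℝ) : ℝ :=
  if x = 0 then t ^ (μ - 1) / (3 * Real.Gamma μ) else Gfun α μ x t


noncomputable def bcf (β : ℝ) (n : ℕ) : ℂ := 1 / ((n.factorial : ℂ) * Complex.Gamma (-(β * n)))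

noncomputable def fW (β : ℝ) (z : ℂ) : ℂ := ∑' n : ℕ, bcf β n * z ^ n

lemma gamma_fac_summable {β : ℝ} (h0 : 0 < β) (h1 : β < 1) {R : ℝ} (hR : 0 < R) :
    Summable (fun n : ℕ => R ^ n / n.factorial * Real.Gamma (1 + β * n)) := by
  have key : Summable (fun n : ℕ => R ^ n / n.factorial * (n.factorial : ℝ) ^ β) := by
    apply summable_of_ratio_test_tendsto_lt_one (l := 0) one_pos
    · filter_upwards with n
      positivity
    · have : Tendsto (fun n : ℕ => R * ((n + 1 : ℕ) : ℝ) ^ (-(1 - β))) atTop (𝓝 (R * 0)) := by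
        apply Tendsto.const_mul
        exact (tendsto_rpow_neg_atTop (by linarith)).comp
          (tendsto_natCast_atTop_atTop.comp (tendsto_add_atTop_nat 1))
      rw [mul_zero] at this
      refine this.congr (fun n => ?_)
      rw [Real.norm_of_nonneg (by positivity), Real.norm_of_nonneg (by positivity)]
      have hn : (0:ℝ) < ((n + 1 : ℕ) : ℝ) := by positivity
      have hf : (0:ℝ) < (n.factorial : ℝ) := by positivity
      rw [Nat.factorial_succ]
      push_cast at hn ⊢
      rw [Real.mul_rpow hn.le hf.le, show -(1 - β) = β - 1 by ring, Real.rpow_sub_one hn.ne']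
      have : (0:ℝ) < (n.factorial : ℝ) ^ β := by positivity
      field_simp
      ring
  refine Summable.of_nonneg_of_le (fun n => ?_) (fun n => ?_) key
  · have : 0 < Real.Gamma (1 + β * n) := Real.Gamma_pos_of_pos (by positivity)
    positivity
  · gcongr
    have := Real.Gamma_mul_add_mul_le_rpow_Gamma_mul_rpow_Gamma (s := n + 1) (t := 1) (a := β)
      (b := 1 - β) (by positivity) one_pos h0 (by linarith) (by ring)
    rw [Real.Gamma_one, Real.one_rpow, mul_one, mul_one, Real.Gamma_nat_eq_factorial] at this
    rw [show 1 + β * (n:ℝ) = β * (n + 1) + (1 - β) by ring]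
    exact this

lemma bcf_eq {β : ℝ} (h0 : 0 < β) (n : ℕ) :
    bcf β n = -(1 / (2 * π * Complex.I)) * ((Real.Gamma (1 + β * n) : ℂ) / n.factorial) *
      (Complex.exp (Complex.I * (π * β * n)) - Complex.exp (-(Complex.I * (π * β * n)))) := by
  have h := Complex.Gamma_mul_Gamma_one_sub (-(β * n))
  have hG : Complex.Gamma (1 - (-(β * n))) = (Real.Gamma (1 + β * n) : ℂ) := by
    rw [← Complex.Gamma_ofReal]; congr 1; push_cast; ring
  have hpos : 0 < Real.Gamma (1 + β * n) := Real.Gamma_pos_of_pos (by positivity)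
  have hne : (Real.Gamma (1 + β * n) : ℂ) ≠ 0 := by exact_mod_cast hpos.ne'
  rw [hG] at h
  have hinv : (Complex.Gamma (-(β * n)))⁻¹ =
      Real.Gamma (1 + β * n) * Complex.sin (π * (-(β * n))) / π := by
    have h2 := congrArg (fun x => x⁻¹) h
    simp only [mul_inv, inv_div] at h2
    rw [mul_div_assoc, ← h2]
    field_simp
  have hpi : (π : ℂ) ≠ 0 := by exact_mod_cast Real.pi_ne_zero
  have hfac : (n.factorial : ℂ) ≠ 0 := by exact_mod_cast n.factorial_ne_zero
  unfold bcf
  rw [one_div, mul_inv, hinv, Complex.sin]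
  have e1 : -((π : ℂ) * (-(β * n))) * Complex.I = Complex.I * (π * β * n) := by ring
  have e2 : ((π : ℂ) * (-(β * n))) * Complex.I = -(Complex.I * (π * β * n)) := by ring
  rw [e1, e2]
  have hI : Complex.I ≠ 0 := Complex.I_ne_zero
  field_simp
  rw [Complex.I_sq]; ring

lemma bcf_norm_le {β : ℝ} (h0 : 0 < β) (n : ℕ) :
    ‖bcf β n‖ ≤ Real.Gamma (1 + β * n) / n.factorial := by
  have hpos : 0 < Real.Gamma (1 + β * n) := Real.Gamma_pos_of_pos (by positivity)
  rw [bcf_eq h0]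
  have e1 : ‖Complex.exp (Complex.I * (π * β * n)) - Complex.exp (-(Complex.I * (π * β * n)))‖
      ≤ 2 := by
    refine (norm_sub_le _ _).trans ?_
    have a1 : ‖Complex.exp (Complex.I * (π * β * n))‖ = 1 := by
      rw [Complex.norm_exp]; simp
    have a2 : ‖Complex.exp (-(Complex.I * (π * β * n)))‖ = 1 := by
      rw [Complex.norm_exp]; simp
    rw [a1, a2]; norm_num
  rw [norm_mul, norm_mul]
  have e2 : ‖-(1 / (2 * (π:ℂ) * Complex.I))‖ = 1 / (2 * π) := by
    simp [abs_of_pos Real.pi_pos]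
  have e3 : ‖(Real.Gamma (1 + β * n) : ℂ) / n.factorial‖ = Real.Gamma (1 + β * n) / n.factorial := by
    rw [norm_div, Complex.norm_real, Real.norm_of_nonneg hpos.le]; simp
  rw [e2, e3]
  set g := Real.Gamma (1 + β * n) / n.factorial
  have hg : 0 ≤ g := by positivity
  calc _ ≤ 1 / (2 * π) * g * 2 := by gcongr
    _ = g * (1 / π) := by field_simp
    _ ≤ g * 1 := by
        gcongr
        rw [div_le_one Real.pi_pos]; linarith [Real.pi_gt_three]
    _ = g := mul_one g

lemma bcf_summable {β : ℝ} (h0 : 0 < β) (h1 : β < 1) {R : ℝ} (hR : 0 < R) :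
    Summable (fun n : ℕ => ‖bcf β n‖ * R ^ n) := by
  refine Summable.of_nonneg_of_le (fun n => by positivity) (fun n => ?_)
    (gamma_fac_summable h0 h1 hR)
  calc _ ≤ Real.Gamma (1 + β * n) / n.factorial * R ^ n := by
        gcongr; exact bcf_norm_le h0 n
    _ = _ := by ring

lemma ps_deriv {a a1 : ℕ → ℂ} (hs : ∀ R : ℝ, 0 < R → Summable (fun n : ℕ => ‖a1 n‖ * R ^ n))
    (ha : ∀ n : ℕ, ((n : ℂ) + 1) * a (n + 1) = a1 n) :
    (∀ R : ℝ, 0 < R → Summable (fun n : ℕ => ‖a n‖ * R ^ n)) ∧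
    ∀ z, HasDerivAt (fun z => ∑' n, a n * z ^ n) (∑' n, a1 n * z ^ n) z := by
  refine ⟨fun R hR => ?_, fun z => ?_⟩
  · rw [← summable_nat_add_iff 1]
    refine Summable.of_nonneg_of_le (fun n => by positivity) (fun n => ?_) ((hs R hR).mul_right R)
    rw [pow_succ, ← mul_assoc]
    gcongr
    rw [← ha n, norm_mul]
    have : (1:ℝ) ≤ ‖(n:ℂ) + 1‖ := by
      have : (n:ℂ) + 1 = ((n + 1 : ℕ) : ℂ) := by push_cast; rfl
      rw [this, Complex.norm_natCast]; push_cast; linarith [n.cast_nonneg (α := ℝ)]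
    nlinarith [norm_nonneg (a (n+1))]
  · set R := ‖z‖ + 1 with hR
    have hRp : 0 < R := by positivity
    have key := hasDerivAt_tsum_of_isPreconnected (𝕜 := ℂ) (F := ℂ)
      (u := fun n : ℕ => match n with | 0 => 0 | n + 1 => ‖a1 n‖ * R ^ n)
      (g := fun n z => a n * z ^ n) (g' := fun n z => match n with | 0 => 0 | n + 1 => a1 n * z ^ n)
      (t := Metric.ball 0 R) (y₀ := 0) (y := z)
      ((summable_nat_add_iff 1).1 (hs R hRp)) Metric.isOpen_ball
      (convex_ball (0:ℂ) R).isPreconnected ?_ ?_ (Metric.mem_ball_self hRp) ?_ ?_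
    · rw [Summable.tsum_eq_zero_add] at key
      · simpa using key
      · apply (summable_nat_add_iff 1).1
        refine Summable.of_norm_bounded (hs R hRp) (fun n => ?_)
        simp only [norm_mul, norm_pow]
        gcongr; linarith
    · rintro (_ | n) y hy
      · simpa using hasDerivAt_const y (a 0)
      · have := (hasDerivAt_pow (n + 1) y).const_mul (a (n + 1))
        have e : a1 n * y ^ n = a (n + 1) * (((n + 1 : ℕ) : ℂ) * y ^ (n + 1 - 1)) := by
          rw [← ha n, Nat.add_sub_cancel]
          push_cast
          ring
        change HasDerivAt _ (a1 n * y ^ n) y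
        rw [e]
        exact this
    · rintro (_ | n) y hy
      · simp
      · have : ‖y‖ ≤ R := by simpa using (mem_ball_zero_iff.1 hy).le
        simp only [norm_mul, norm_pow]
        gcongr
    · apply summable_of_ne_finset_zero (s := {0})
      intro n hn
      have : n ≠ 0 := by simpa using hn
      simp [this]
    · simp [hR]

lemma cexp_norm_aux (b : ℂ) (x : ℝ) : ‖Complex.exp (-(b * x))‖ = rexp (-(b.re * x)) := by
  rw [Complex.norm_exp]; simp

lemma rgam_int {s κ : ℝ} (hs : 0 < s) (hκ : 0 < κ) :
    IntegrableOn (fun x : ℝ => x ^ (s - 1) * rexp (-(κ * x))) (Ioi 0) := by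
  have := integrableOn_rpow_mul_exp_neg_mul_rpow (p := 1) (s := s - 1) (b := κ) (by linarith)
    one_pos hκ
  simpa using this

lemma cgam_meas (s : ℝ) (b : ℂ) (μ : Measure ℝ) :
    AEStronglyMeasurable (fun x : ℝ => ((x ^ (s - 1) : ℝ) : ℂ) * Complex.exp (-(b * x))) μ := by
  apply Measurable.aestronglyMeasurable
  fun_prop

lemma cgam_int {s : ℝ} (hs : 0 < s) {b : ℂ} (hb : 0 < b.re) :
    IntegrableOn (fun x : ℝ => ((x ^ (s - 1) : ℝ) : ℂ) * Complex.exp (-(b * x))) (Ioi 0) := by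
  refine Integrable.mono' (rgam_int hs hb) (cgam_meas s b _) ?_
  filter_upwards [ae_restrict_mem measurableSet_Ioi] with x hx
  rw [norm_mul, cexp_norm_aux, Complex.norm_real, Real.norm_of_nonneg (rpow_nonneg (le_of_lt hx) _)]

lemma cgam_diff {s : ℝ} (hs : 0 < s) {b : ℂ} (hb : 0 < b.re) :
    DifferentiableAt ℂ (fun b : ℂ => ∫ x : ℝ in Ioi 0,
      ((x ^ (s - 1) : ℝ) : ℂ) * Complex.exp (-(b * x))) b := by
  have hU : {c : ℂ | b.re / 2 < c.re} ∈ 𝓝 b :=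
    (isOpen_lt continuous_const Complex.continuous_re).mem_nhds (by simp; linarith)
  refine (hasDerivAt_integral_of_dominated_loc_of_deriv_le (μ := volume.restrict (Ioi 0)) (𝕜 := ℂ)
    (F := fun (b : ℂ) (x : ℝ) => ((x ^ (s - 1) : ℝ) : ℂ) * Complex.exp (-(b * x)))
    (F' := fun (b : ℂ) (x : ℝ) => ((x ^ (s - 1) : ℝ) : ℂ) * (Complex.exp (-(b * x)) * (-x)))
    (bound := fun x : ℝ => x ^ (s + 1 - 1) * rexp (-(b.re / 2 * x)))
    hU (Eventually.of_forall fun c => cgam_meas s c _) (cgam_int hs hb) ?_ ?_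
    (rgam_int (by linarith) (by linarith)) ?_).2.differentiableAt
  · apply Measurable.aestronglyMeasurable
    fun_prop
  · filter_upwards [ae_restrict_mem measurableSet_Ioi] with x hx c hc
    have hx' : (0:ℝ) < x := hx
    have hc' : b.re / 2 < c.re := hc
    rw [norm_mul, norm_mul, cexp_norm_aux, Complex.norm_real, norm_neg, Complex.norm_real,
      Real.norm_of_nonneg (rpow_nonneg hx'.le _), Real.norm_of_nonneg hx'.le,
      show s + 1 - 1 = (s - 1) + 1 by ring, Real.rpow_add_one hx'.ne']
    have : rexp (-(c.re * x)) ≤ rexp (-(b.re / 2 * x)) := by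
      apply Real.exp_le_exp.2; nlinarith
    calc _ ≤ x ^ (s - 1) * (rexp (-(b.re / 2 * x)) * x) := by gcongr
      _ = _ := by ring
  · filter_upwards with x c hc
    have h1 : HasDerivAt (fun c : ℂ => -(c * x)) (-x : ℂ) c := by
      have := ((hasDerivAt_id c).mul_const (x : ℂ)).neg
      rw [one_mul] at this
      exact this
    exact (h1.cexp).const_mul _

lemma cgam_eval' {s : ℝ} (hs : 0 < s) {b : ℂ} (hb : 0 < b.re) :
    ∫ x : ℝ in Ioi 0, ((x ^ (s - 1) : ℝ) : ℂ) * Complex.exp (-(b * x)) =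
      b ^ (-(s : ℂ)) * Real.Gamma s := by
  have hopen : IsOpen {c : ℂ | 0 < c.re} := isOpen_lt continuous_const Complex.continuous_re
  have hconv : Convex ℝ {c : ℂ | 0 < c.re} := convex_halfSpace_re_gt 0
  refine AnalyticOnNhd.eqOn_of_preconnected_of_frequently_eq (𝕜 := ℂ) (z₀ := 1)
    (f := fun b : ℂ => ∫ x : ℝ in Ioi 0,
      ((x ^ (s - 1) : ℝ) : ℂ) * Complex.exp (-(b * x)))
    (g := fun b => b ^ (-(s : ℂ)) * Real.Gamma s)
    (DifferentiableOn.analyticOnNhd (fun c hc => (cgam_diff hs hc).differentiableWithinAt) hopen)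
    (DifferentiableOn.analyticOnNhd (fun c hc => ?_) hopen)
    hconv.isPreconnected (show (0:ℝ) < (1:ℂ).re by simp) ?_ hb
  · apply DifferentiableAt.differentiableWithinAt
    have : c ∈ Complex.slitPlane := Or.inl hc
    fun_prop (disch := assumption)
  · have hreal : ∀ r : ℝ, 0 < r → (∫ x : ℝ in Ioi 0,
        ((x ^ (s - 1) : ℝ) : ℂ) * Complex.exp (-((r:ℂ) * x))) =
        (r:ℂ) ^ (-(s : ℂ)) * Real.Gamma s := by
      intro r hr
      have h1 := Real.integral_rpow_mul_exp_neg_mul_Ioi hs hr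
      have h2 := congrArg (fun x : ℝ => (x : ℂ)) h1
      rw [← integral_complex_ofReal] at h2
      rw [show (r:ℂ) ^ (-(s : ℂ)) = (((1 / r) ^ s : ℝ) : ℂ) by
        rw [one_div, Real.inv_rpow hr.le, ← Real.rpow_neg hr.le, Complex.ofReal_cpow hr.le]
        push_cast; rfl]
      push_cast at h2 ⊢
      exact h2
    have htend : Tendsto (fun n : ℕ => (((1 + 1 / ((n:ℝ) + 1) : ℝ)) : ℂ)) atTop (𝓝[≠] 1) := by
      apply tendsto_nhdsWithin_iff.2 ⟨?_, ?_⟩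
      · have : Tendsto (fun n : ℕ => 1 + 1 / ((n:ℝ) + 1)) atTop (𝓝 (1 + 0)) :=
          tendsto_one_div_add_atTop_nhds_zero_nat.const_add 1
        rw [add_zero] at this
        have h3 := (Complex.continuous_ofReal.tendsto 1).comp this
        rw [Complex.ofReal_one] at h3
        exact h3
      · filter_upwards with n
        have : (0:ℝ) < 1 / ((n:ℝ) + 1) := by positivity
        simp only [mem_compl_iff, mem_singleton_iff]
        intro h
        have : (1 + 1 / ((n:ℝ) + 1) : ℝ) = 1 := by exact_mod_cast h
        linarith
    exact htend.frequently (Frequently.of_forall fun n => hreal _ (by positivity))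

lemma cgam_eval {s : ℝ} (hs : 0 < s) {δ : ℝ} (hδ : |δ| < π / 2) :
    ∫ x : ℝ in Ioi 0, ((x ^ (s - 1) : ℝ) : ℂ) *
      Complex.exp (-(Complex.exp (Complex.I * δ) * x)) =
      Complex.exp (-(Complex.I * (δ * s))) * Real.Gamma s := by
  rw [abs_lt] at hδ
  have hre : (Complex.exp (Complex.I * δ)).re = Real.cos δ := by
    rw [mul_comm, Complex.exp_mul_I, ← Complex.ofReal_cos, ← Complex.ofReal_sin]; simp [Complex.cos_ofReal_re]
  rw [cgam_eval' hs (by rw [hre]; exact Real.cos_pos_of_mem_Ioo ⟨by linarith, by linarith⟩)]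
  congr 1
  rw [Complex.cpow_def_of_ne_zero (Complex.exp_ne_zero _), Complex.log_exp]
  · congr 1; ring
  · simp; linarith [Real.pi_pos]
  · simp; linarith [Real.pi_pos]

lemma exp_I_re (δ : ℝ) : (Complex.exp (Complex.I * δ)).re = Real.cos δ := by
  rw [mul_comm, Complex.exp_mul_I, ← Complex.ofReal_cos, ← Complex.ofReal_sin]
  simp [Complex.cos_ofReal_re]

lemma cos_pos_abs {δ : ℝ} (hδ : |δ| < π / 2) : 0 < Real.cos δ := by
  rw [abs_lt] at hδ
  exact Real.cos_pos_of_mem_Ioo ⟨by linarith, by linarith⟩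

noncomputable def JW (β δ : ℝ) (z : ℂ) : ℂ :=
  Complex.exp (Complex.I * δ) * ∫ ρ : ℝ in Ioi 0,
    Complex.exp (-(Complex.exp (Complex.I * δ) * ρ)) * Complex.exp (z * ((ρ ^ β : ℝ) : ℂ))

lemma hasSum_congr_both {f g : ℕ → ℂ} {x y : ℂ} (h : ∀ n, f n = g n) (hxy : x = y) :
    HasSum f x ↔ HasSum g y := by
  rw [funext h, hxy]

lemma JW_hasSum {β : ℝ} (h0 : 0 < β) (h1 : β < 1) {δ : ℝ} (hδ : |δ| < π / 2) (z : ℂ) :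
    HasSum (fun n : ℕ => z ^ n / n.factorial * Real.Gamma (1 + β * n) *
      Complex.exp (-(Complex.I * (δ * (β * n))))) (JW β δ z) := by
  set b := Complex.exp (Complex.I * δ) with hb
  have hκ : 0 < b.re := by rw [hb, exp_I_re]; exact cos_pos_abs hδ
  have hs : ∀ n : ℕ, 0 < 1 + β * n := fun n => by positivity
  have H := hasSum_integral_of_summable_integral_norm (μ := volume.restrict (Ioi (0:ℝ)))
    (F := fun (n : ℕ) (ρ : ℝ) => z ^ n / n.factorial *
      (((ρ ^ (1 + β * n - 1) : ℝ) : ℂ) * Complex.exp (-(b * ρ))))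
    (fun n => (cgam_int (hs n) hκ).const_mul _) ?_
  · have H2 := H.mul_left b
    refine (hasSum_congr_both ?_ ?_).2 H2
    · intro n
      rw [integral_const_mul, cgam_eval (hs n) hδ]
      have : b * Complex.exp (-(Complex.I * (δ * ((1 + β * n : ℝ) : ℂ)))) =
          Complex.exp (-(Complex.I * (δ * (β * n)))) := by
        rw [hb, ← Complex.exp_add]; congr 1; push_cast; ring
      rw [← this]
      ring
    · unfold JW
      rw [← hb]
      congr 1
      refine setIntegral_congr_fun measurableSet_Ioi (fun ρ hρ => ?_)
      have hρ' : (0:ℝ) < ρ := hρ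
      have hexp : HasSum (fun n : ℕ => (z * ((ρ ^ β : ℝ) : ℂ)) ^ n / n.factorial)
          (Complex.exp (z * ((ρ ^ β : ℝ) : ℂ))) := by
        rw [Complex.exp_eq_exp_ℂ]
        exact NormedSpace.expSeries_div_hasSum_exp (𝔸 := ℂ) _
      have h3 := hexp.mul_left (Complex.exp (-(b * ρ)))
      rw [← h3.tsum_eq]
      refine tsum_congr (fun n => ?_)
      rw [add_sub_cancel_left, Real.rpow_mul hρ'.le, Real.rpow_natCast, mul_pow]
      push_cast
      ring
  · have hR : 0 < (‖z‖ + 1) * (1 / b.re) ^ β := by positivity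
    refine Summable.of_nonneg_of_le (fun n => integral_nonneg fun _ => norm_nonneg _)
      (fun n => ?_) ((gamma_fac_summable h0 h1 hR).mul_left (1 / b.re))
    have e : ∫ ρ : ℝ in Ioi 0, ‖z ^ n / n.factorial *
        (((ρ ^ (1 + β * n - 1) : ℝ) : ℂ) * Complex.exp (-(b * ρ)))‖ =
        ∫ ρ : ℝ in Ioi 0, ‖z‖ ^ n / n.factorial *
          (ρ ^ (1 + β * n - 1) * rexp (-(b.re * ρ))) := by
      refine setIntegral_congr_fun measurableSet_Ioi (fun ρ hρ => ?_)
      have hρ' : (0:ℝ) < ρ := hρ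
      simp only [norm_mul, norm_div, norm_pow, cexp_norm_aux, Complex.norm_real,
        Complex.norm_natCast]
      rw [Real.norm_of_nonneg (rpow_nonneg hρ'.le _)]
    rw [e, integral_const_mul, Real.integral_rpow_mul_exp_neg_mul_Ioi (hs n) hκ,
      Real.rpow_add (by positivity), Real.rpow_one, Real.rpow_mul (by positivity),
      Real.rpow_natCast, mul_pow]
    have hG : 0 < Real.Gamma (1 + β * n) := Real.Gamma_pos_of_pos (hs n)
    calc _ = 1 / b.re * (‖z‖ ^ n * ((1 / b.re) ^ β) ^ n / n.factorial * Real.Gamma (1 + β * n)) := by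
          ring
      _ ≤ _ := by
          gcongr
          linarith

lemma fW_eq {β : ℝ} (h0 : 0 < β) (h1 : β < 1) {d : ℝ} (hd : |d| < π / 2) (z : ℂ) :
    fW β z = -(1 / (2 * π * Complex.I)) *
      (JW β (-d) (z * Complex.exp (Complex.I * ((π - d) * β))) -
        JW β d (z * Complex.exp (-(Complex.I * ((π - d) * β))))) := by
  have H1 := JW_hasSum h0 h1 (δ := -d) (by rwa [abs_neg])
    (z * Complex.exp (Complex.I * ((π - d) * β)))
  have H2 := JW_hasSum h0 h1 (δ := d) hd (z * Complex.exp (-(Complex.I * ((π - d) * β))))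
  have H := (H1.sub H2).mul_left (-(1 / (2 * π * Complex.I)))
  rw [← H.tsum_eq]
  unfold fW
  refine tsum_congr (fun n => ?_)
  rw [bcf_eq h0, mul_pow, mul_pow, ← Complex.exp_nat_mul, ← Complex.exp_nat_mul]
  have e1 : Complex.exp (Complex.I * (π * β * n)) =
      Complex.exp (n * (Complex.I * ((π - d) * β))) *
      Complex.exp (-(Complex.I * (((-d : ℝ) : ℂ) * (β * n)))) := by
    rw [← Complex.exp_add]; congr 1; push_cast; ring
  have e2 : Complex.exp (-(Complex.I * (π * β * n))) =
      Complex.exp (n * (-(Complex.I * ((π - d) * β)))) *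
      Complex.exp (-(Complex.I * (d * (β * n)))) := by
    rw [← Complex.exp_add]; congr 1; push_cast; ring
  rw [e1, e2]
  ring

noncomputable def LW (β δ θ σ : ℝ) : ℂ :=
  Complex.exp (Complex.I * δ) * ∫ r : ℝ in Ioi 0,
    Complex.exp (-(Complex.exp (Complex.I * δ) * (σ * r))) *
      Complex.exp (-(Complex.exp (Complex.I * θ) * ((r ^ β : ℝ) : ℂ)))

lemma JW_LW {β : ℝ} (δ θ : ℝ) {σ : ℝ} (hσ : 0 < σ) (z : ℂ) (hz : z = -Complex.exp (Complex.I * θ)) :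
    (σ : ℂ)⁻¹ * JW β δ (z * ((σ ^ (-β) : ℝ) : ℂ)) = LW β δ θ σ := by
  unfold JW LW
  have := integral_comp_mul_left_Ioi (fun ρ : ℝ =>
    Complex.exp (-(Complex.exp (Complex.I * δ) * ρ)) *
      Complex.exp (z * ((σ ^ (-β) : ℝ) : ℂ) * ((ρ ^ β : ℝ) : ℂ))) 0 hσ
  rw [mul_zero] at this
  rw [mul_left_comm]
  congr 1
  rw [Complex.real_smul, Complex.ofReal_inv] at this
  rw [← this]
  refine setIntegral_congr_fun measurableSet_Ioi (fun r hr => ?_)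
  have hr' : (0:ℝ) < r := hr
  congr 2
  · push_cast; ring
  · rw [hz, Real.mul_rpow hσ.le hr'.le, Real.rpow_neg hσ.le]
    have : ((σ ^ β : ℝ) : ℂ) ≠ 0 := by exact_mod_cast (Real.rpow_pos_of_pos hσ β).ne'
    push_cast at this ⊢
    field_simp

lemma gexp_int {β κ : ℝ} (h0 : 0 < β) (hκ : 0 < κ) :
    IntegrableOn (fun r : ℝ => rexp (-κ * r ^ β)) (Ioi 0) := by
  have := integrableOn_rpow_mul_exp_neg_mul_rpow (p := β) (s := 0) (b := κ) (by norm_num) h0 hκ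
  simpa using this

lemma LW_bound {β : ℝ} (h0 : 0 < β) {δ θ : ℝ} (hδ : |δ| < π / 2) (hθ : |θ| < π / 2) :
    ∃ C, ∀ σ, 0 < σ → ‖LW β δ θ σ‖ ≤ C := by
  refine ⟨∫ r in Ioi 0, rexp (-Real.cos θ * r ^ β), fun σ hσ => ?_⟩
  unfold LW
  rw [norm_mul]
  have : ‖Complex.exp (Complex.I * δ)‖ = 1 := by rw [Complex.norm_exp]; simp
  rw [this, one_mul]
  refine norm_integral_le_of_norm_le (gexp_int h0 (cos_pos_abs hθ)) ?_
  filter_upwards [ae_restrict_mem measurableSet_Ioi] with r hr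
  have hr' : (0:ℝ) < r := hr
  rw [norm_mul, cexp_norm_aux, ← Complex.ofReal_mul, cexp_norm_aux, exp_I_re, exp_I_re]
  have : rexp (-(Real.cos δ * (σ * r))) ≤ 1 := by
    apply Real.exp_le_one_iff.2
    have := cos_pos_abs hδ
    have : 0 < Real.cos δ * (σ * r) := by positivity
    linarith
  calc _ ≤ 1 * rexp (-(Real.cos θ * r ^ β)) := by gcongr
    _ = _ := by rw [one_mul, neg_mul]

lemma stretched_eval {β s : ℝ} (h0 : 0 < β) (hs : 0 < s) {θ : ℝ} (hθ : |θ| < π / 2) :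
    ∫ r : ℝ in Ioi 0, ((r ^ (s - 1) : ℝ) : ℂ) *
      Complex.exp (-(Complex.exp (Complex.I * θ) * ((r ^ β : ℝ) : ℂ))) =
    Complex.exp (-(Complex.I * (θ * (s / β)))) * (Real.Gamma (s / β) / β) := by
  have h := integral_comp_rpow_Ioi (fun u : ℝ => ((u ^ (s / β - 1) : ℝ) : ℂ) *
      Complex.exp (-(Complex.exp (Complex.I * θ) * u))) h0.ne'
  rw [cgam_eval (by positivity) hθ] at h
  have hb : (β : ℂ) ≠ 0 := by exact_mod_cast h0.ne'
  have e : ∀ r ∈ Ioi (0:ℝ), (|β| * r ^ (β - 1)) • ((((r ^ β) ^ (s / β - 1) : ℝ) : ℂ) *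
      Complex.exp (-(Complex.exp (Complex.I * θ) * ((r ^ β : ℝ) : ℂ)))) =
      (β : ℂ) * (((r ^ (s - 1) : ℝ) : ℂ) *
      Complex.exp (-(Complex.exp (Complex.I * θ) * ((r ^ β : ℝ) : ℂ)))) := by
    intro r hr
    have hr' : (0:ℝ) < r := hr
    rw [Complex.real_smul, abs_of_pos h0, ← Real.rpow_mul hr'.le, ← mul_assoc, ← mul_assoc,
      ← Complex.ofReal_mul, ← Complex.ofReal_mul, mul_assoc β, ← Real.rpow_add hr']
    congr 4
    field_simp
    ring
  rw [setIntegral_congr_fun measurableSet_Ioi e, integral_const_mul] at h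
  rw [eq_div_of_mul_eq hb ((mul_comm _ _).trans h)]
  push_cast
  ring

lemma b_cpow {δ r s : ℝ} (hδ : |δ| < π / 2) (hr : 0 < r) :
    (Complex.exp (Complex.I * δ) * r) ^ (-(((1 - s : ℝ)) : ℂ)) =
      Complex.exp (-(Complex.I * (δ * (1 - s)))) * ((r ^ (s - 1) : ℝ) : ℂ) := by
  rw [abs_lt] at hδ
  have hrc : (r : ℂ) ≠ 0 := by exact_mod_cast hr.ne'
  rw [Complex.cpow_def_of_ne_zero (mul_ne_zero (Complex.exp_ne_zero _) hrc),
    Complex.log_mul_ofReal _ hr _ (Complex.exp_ne_zero _), Complex.log_exp,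
    Real.rpow_def_of_pos hr, Complex.ofReal_exp, ← Complex.exp_add]
  · congr 1; push_cast; ring
  · simp; linarith [Real.pi_pos]
  · simp; linarith [Real.pi_pos]

lemma LW_mellin {β : ℝ} (h0 : 0 < β) {δ θ s : ℝ} (hδ : |δ| < π / 2) (hθ : |θ| < π / 2)
    (hs : 0 < s) (hs1 : s < 1) :
    IntegrableOn (fun σ : ℝ => ((σ ^ (-s) : ℝ) : ℂ) * LW β δ θ σ) (Ioi 0) ∧
    ∫ σ : ℝ in Ioi 0, ((σ ^ (-s) : ℝ) : ℂ) * LW β δ θ σ =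
      Real.Gamma (1 - s) * (Real.Gamma (s / β) / β) *
        Complex.exp (-(Complex.I * (s * (θ / β - δ)))) := by
  set b := Complex.exp (Complex.I * δ) with hb
  set e := Complex.exp (Complex.I * θ) with he
  have hκ : 0 < b.re := by rw [hb, exp_I_re]; exact cos_pos_abs hδ
  have hκ' : 0 < e.re := by rw [he, exp_I_re]; exact cos_pos_abs hθ
  have hG : 0 < Real.Gamma (1 - s) := Real.Gamma_pos_of_pos (by linarith)
  set H : ℝ → ℝ → ℂ := fun σ r => ((σ ^ (-s) : ℝ) : ℂ) *
    (Complex.exp (-(b * (σ * r))) * Complex.exp (-(e * ((r ^ β : ℝ) : ℂ)))) with hH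
  have hHr : ∀ r σ : ℝ, H σ r = Complex.exp (-(e * ((r ^ β : ℝ) : ℂ))) *
      (((σ ^ ((1 - s) - 1) : ℝ) : ℂ) * Complex.exp (-((b * r) * σ))) := by
    intro r σ
    simp only [hH]
    rw [show (1 - s) - 1 = -s by ring, show b * (σ * r : ℂ) = (b * r) * σ by ring]
    ring
  have hbr : ∀ r : ℝ, 0 < r → 0 < (b * r).re := by
    intro r hr; simp only [Complex.re_mul_ofReal]; positivity
  have hint : Integrable (Function.uncurry H)
      ((volume.restrict (Ioi (0:ℝ))).prod (volume.restrict (Ioi (0:ℝ)))) := by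
    rw [integrable_prod_iff']
    · refine ⟨?_, ?_⟩
      · filter_upwards [ae_restrict_mem measurableSet_Ioi] with r hr
        simp only [Function.uncurry, hHr]
        exact (cgam_int (by linarith) (hbr r hr)).const_mul _
      · have hI : IntegrableOn (fun r : ℝ => ((1 / b.re) ^ (1 - s) * Real.Gamma (1 - s)) *
            (r ^ (s - 1) * rexp (-e.re * r ^ β))) (Ioi 0) :=
          (integrableOn_rpow_mul_exp_neg_mul_rpow (by linarith) h0 hκ').const_mul _
        refine hI.congr ?_
        filter_upwards [ae_restrict_mem measurableSet_Ioi] with r hr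
        have hr' : (0:ℝ) < r := hr
        simp only [Function.uncurry, hHr, norm_mul]
        have e1 : ∀ σ ∈ Ioi (0:ℝ), ‖Complex.exp (-(e * ((r ^ β : ℝ) : ℂ)))‖ *
            (‖((σ ^ ((1 - s) - 1) : ℝ) : ℂ)‖ * ‖Complex.exp (-((b * r) * σ))‖) =
            rexp (-(e.re * r ^ β)) * (σ ^ ((1 - s) - 1) * rexp (-((b.re * r) * σ))) := by
          intro σ hσ
          rw [cexp_norm_aux, cexp_norm_aux, Complex.re_mul_ofReal, Complex.norm_real,
            Real.norm_of_nonneg (rpow_nonneg (le_of_lt hσ) _)]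
        rw [setIntegral_congr_fun measurableSet_Ioi e1, integral_const_mul,
          Real.integral_rpow_mul_exp_neg_mul_Ioi (by linarith) (by positivity)]
        rw [show (1 / (b.re * r)) = (1 / b.re) * (1 / r) by field_simp,
          Real.mul_rpow (by positivity) (by positivity), one_div r, Real.inv_rpow hr'.le,
          ← Real.rpow_neg hr'.le, show -(1 - s) = s - 1 by ring, neg_mul]
        ring
    · apply Measurable.aestronglyMeasurable
      simp only [hH, Function.uncurry_def]
      fun_prop
  have hL : ∀ σ : ℝ, ((σ ^ (-s) : ℝ) : ℂ) * LW β δ θ σ = b * ∫ r in Ioi 0, H σ r := by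
    intro σ
    simp only [hH, LW]
    rw [integral_const_mul]
    ring
  simp only [hL]
  refine ⟨hint.integral_prod_left.const_mul b, ?_⟩
  rw [integral_const_mul, integral_integral_swap hint]
  have e2 : ∀ r ∈ Ioi (0:ℝ), ∫ σ in Ioi 0, H σ r =
      (Complex.exp (-(Complex.I * (δ * (1 - s)))) * Real.Gamma (1 - s)) *
      (((r ^ (s - 1) : ℝ) : ℂ) * Complex.exp (-(e * ((r ^ β : ℝ) : ℂ)))) := by
    intro r hr
    simp only [hHr]
    rw [integral_const_mul, cgam_eval' (by linarith) (hbr r hr), hb, b_cpow hδ hr]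
    ring
  rw [setIntegral_congr_fun measurableSet_Ioi e2, integral_const_mul, he,
    stretched_eval h0 hs hθ]
  have e3 : Complex.exp (-(Complex.I * (s * (θ / β - δ)))) =
      b * Complex.exp (-(Complex.I * (δ * (1 - s)))) * Complex.exp (-(Complex.I * (θ * (s / β)))) := by
    rw [hb, ← Complex.exp_add, ← Complex.exp_add]; congr 1; ring
  rw [e3]
  ring

noncomputable def kW (β : ℝ) (c : ℂ) (σ : ℝ) : ℂ := (σ : ℂ)⁻¹ * fW β (c * ((σ ^ (-β) : ℝ) : ℂ))

lemma kW_eq {β : ℝ} (h0 : 0 < β) (h1 : β < 1) {d γ : ℝ} (hd : |d| < π / 2) {σ : ℝ} (hσ : 0 < σ) :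
    kW β (-Complex.exp (Complex.I * γ)) σ = -(1 / (2 * π * Complex.I)) *
      (LW β (-d) (γ + (π - d) * β) σ - LW β d (γ - (π - d) * β) σ) := by
  unfold kW
  rw [fW_eq h0 h1 hd]
  rw [← JW_LW (-d) (γ + (π - d) * β) hσ
      (-Complex.exp (Complex.I * γ) * Complex.exp (Complex.I * ((π - d) * β)))
      (by rw [neg_mul, ← Complex.exp_add]; congr 2; push_cast; ring),
    ← JW_LW d (γ - (π - d) * β) hσ
      (-Complex.exp (Complex.I * γ) * Complex.exp (-(Complex.I * ((π - d) * β))))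
      (by rw [neg_mul, ← Complex.exp_add]; congr 2; push_cast; ring)]
  rw [mul_right_comm (-Complex.exp (Complex.I * γ)) _ (Complex.exp (Complex.I * ((π - d) * β))),
    mul_right_comm (-Complex.exp (Complex.I * γ)) _ (Complex.exp (-(Complex.I * ((π - d) * β))))]
  ring

lemma fW_cont {β : ℝ} (h0 : 0 < β) (h1 : β < 1) : Continuous (fW β) := by
  refine continuous_iff_continuousAt.2 (fun z => ?_)
  have hon : ContinuousOn (fW β) (Metric.ball 0 (‖z‖ + 1)) := by
    refine continuousOn_tsum (u := fun n => ‖bcf β n‖ * (‖z‖ + 1) ^ n) (fun n => by fun_prop)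
      (bcf_summable h0 h1 (by positivity)) (fun n x hx => ?_)
    rw [norm_mul, norm_pow]
    have := (mem_ball_zero_iff.1 hx).le
    gcongr
  exact hon.continuousAt (Metric.isOpen_ball.mem_nhds (by simp))

lemma kW_meas {β : ℝ} (h0 : 0 < β) (h1 : β < 1) (c : ℂ) : Measurable (kW β c) := by
  unfold kW
  have := (fW_cont h0 h1).measurable
  fun_prop

lemma fW_small {β : ℝ} (h0 : 0 < β) (h1 : β < 1) :
    ∃ S, ∀ z : ℂ, ‖z‖ ≤ 1 → ‖fW β z‖ ≤ S * ‖z‖ := by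
  have hs := bcf_summable h0 h1 one_pos
  simp only [one_pow, mul_one] at hs
  refine ⟨∑' n, ‖bcf β n‖, fun z hz => ?_⟩
  unfold fW
  refine tsum_of_norm_bounded (hs.mul_right ‖z‖).hasSum (fun n => ?_) |>.trans
    (le_of_eq (tsum_mul_right ..))
  rcases n with _ | n
  · have : bcf β 0 = 0 := by simp [bcf]
    simp [this]
  · rw [norm_mul, norm_pow]
    gcongr
    exact pow_le_of_le_one (norm_nonneg _) hz (by simp)

lemma kW_bound {β : ℝ} (h0 : 0 < β) (h1 : β < 1) {d γ : ℝ} (hd : |d| < π / 2)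
    (hp : |γ + (π - d) * β| < π / 2) (hm : |γ - (π - d) * β| < π / 2) :
    ∃ C, 0 ≤ C ∧ ∀ σ, 0 < σ → ‖kW β (-Complex.exp (Complex.I * γ)) σ‖ ≤ C ∧
      (1 ≤ σ → ‖kW β (-Complex.exp (Complex.I * γ)) σ‖ ≤ C * σ ^ (-1 - β)) := by
  obtain ⟨C1, hC1⟩ := LW_bound h0 (δ := -d) (by rwa [abs_neg]) hp
  obtain ⟨C2, hC2⟩ := LW_bound h0 hd hm
  obtain ⟨S, hS⟩ := fW_small h0 h1
  refine ⟨max 0 (max (‖-(1 / (2 * π * Complex.I))‖ * (C1 + C2)) S), le_max_left _ _,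
    fun σ hσ => ⟨?_, fun hσ1 => ?_⟩⟩
  · rw [kW_eq h0 h1 hd hσ, norm_mul]
    refine le_trans ?_ ((le_max_left _ _).trans (le_max_right _ _))
    gcongr
    exact (norm_sub_le _ _).trans (add_le_add (hC1 σ hσ) (hC2 σ hσ))
  · unfold kW
    have hn : ‖-Complex.exp (Complex.I * γ) * ((σ ^ (-β) : ℝ) : ℂ)‖ = σ ^ (-β) := by
      rw [norm_mul, norm_neg, Complex.norm_exp, Complex.norm_real,
        Real.norm_of_nonneg (rpow_nonneg hσ.le _)]
      simp
    have h := hS (-Complex.exp (Complex.I * γ) * ((σ ^ (-β) : ℝ) : ℂ))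
      (by rw [hn]; exact Real.rpow_le_one_of_one_le_of_nonpos hσ1 (by linarith))
    rw [hn] at h
    rw [norm_mul, norm_inv, Complex.norm_real, Real.norm_of_nonneg hσ.le]
    calc _ ≤ σ⁻¹ * (S * σ ^ (-β)) := by gcongr
      _ = S * σ ^ (-1 - β) := by
          rw [sub_eq_add_neg, Real.rpow_add hσ, Real.rpow_neg_one]; ring
      _ ≤ _ := by
          gcongr
          exact (le_max_right _ _).trans (le_max_right _ _)

lemma kW_total {β : ℝ} (h0 : 0 < β) (h1 : β < 1) {d γ : ℝ} (hd : |d| < π / 2)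
    (hp : |γ + (π - d) * β| < π / 2) (hm : |γ - (π - d) * β| < π / 2) :
    IntegrableOn (kW β (-Complex.exp (Complex.I * γ))) (Ioi 0) ∧
    ∫ σ in Ioi 0, kW β (-Complex.exp (Complex.I * γ)) σ = 1 := by
  set k := kW β (-Complex.exp (Complex.I * γ)) with hk
  obtain ⟨C, hC0, hC⟩ := kW_bound h0 h1 hd hp hm
  rw [← hk] at hC
  have hmeas : Measurable k := kW_meas h0 h1 _
  set B : ℝ → ℝ := fun σ => if σ ≤ 1 then C * σ ^ (-(1/2) : ℝ) else C * σ ^ (-1 - β) with hB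
  have hBint : IntegrableOn B (Ioi 0) := by
    rw [← Ioc_union_Ioi_eq_Ioi zero_le_one]
    apply IntegrableOn.union
    · have : IntegrableOn (fun σ : ℝ => C * σ ^ (-(1/2) : ℝ)) (Ioc 0 1) := by
        apply Integrable.const_mul
        have := intervalIntegral.intervalIntegrable_rpow' (a := 0) (b := 1) (r := -(1/2)) (by norm_num)
        exact (intervalIntegrable_iff_integrableOn_Ioc_of_le zero_le_one).1 this
      refine this.congr_fun (fun σ hσ => ?_) measurableSet_Ioc
      simp only [hB, if_pos hσ.2]
    · have : IntegrableOn (fun σ : ℝ => C * σ ^ (-1 - β)) (Ioi 1) :=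
        (integrableOn_Ioi_rpow_of_lt (by linarith) one_pos).const_mul _
      refine this.congr_fun (fun σ hσ => ?_) measurableSet_Ioi
      simp only [hB, if_neg (not_le.2 (mem_Ioi.1 hσ))]
  have hbd : ∀ s : ℝ, 0 ≤ s → s ≤ 1/2 → ∀ σ : ℝ, 0 < σ →
      ‖((σ ^ (-s) : ℝ) : ℂ) * k σ‖ ≤ B σ := by
    intro s hs0 hs1 σ hσ
    rw [norm_mul, Complex.norm_real, Real.norm_of_nonneg (rpow_nonneg hσ.le _)]
    simp only [hB]
    split_ifs with h
    · have e1 : σ ^ (-s) ≤ σ ^ (-(1/2) : ℝ) :=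
        Real.rpow_le_rpow_of_exponent_ge hσ h (by linarith)
      have e2 := (hC σ hσ).1
      calc _ ≤ σ ^ (-(1/2) : ℝ) * C := by gcongr
        _ = _ := mul_comm _ _
    · have h' : 1 ≤ σ := (not_le.1 h).le
      have e1 : σ ^ (-s) ≤ 1 := Real.rpow_le_one_of_one_le_of_nonpos h' (by linarith)
      have e2 := (hC σ hσ).2 h'
      calc _ ≤ 1 * (C * σ ^ (-1 - β)) := by gcongr
        _ = _ := one_mul _
  have hkint : IntegrableOn k (Ioi 0) := by
    refine Integrable.mono' hBint hmeas.aestronglyMeasurable ?_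
    filter_upwards [ae_restrict_mem measurableSet_Ioi] with σ hσ
    simpa using hbd 0 le_rfl (by norm_num) σ hσ
  refine ⟨hkint, ?_⟩
  have hlim : Tendsto (fun s : ℝ => ∫ σ in Ioi 0, ((σ ^ (-s) : ℝ) : ℂ) * k σ) (𝓝[>] 0)
      (𝓝 (∫ σ in Ioi 0, k σ)) := by
    refine tendsto_integral_filter_of_dominated_convergence B ?_ ?_ hBint ?_
    · filter_upwards with s
      apply Measurable.aestronglyMeasurable
      fun_prop
    · have : ∀ᶠ s : ℝ in 𝓝[>] 0, s ∈ Ioo (0:ℝ) (1/2) :=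
        Ioo_mem_nhdsGT (by norm_num)
      filter_upwards [this] with s hs
      filter_upwards [ae_restrict_mem measurableSet_Ioi] with σ hσ
      exact hbd s hs.1.le hs.2.le σ hσ
    · filter_upwards [ae_restrict_mem measurableSet_Ioi] with σ hσ
      have hσ' : (0:ℝ) < σ := hσ
      have hc : Continuous (fun s : ℝ => ((σ ^ (-s) : ℝ) : ℂ) * k σ) := by
        have : Continuous (fun s : ℝ => σ ^ (-s)) :=
          continuous_const.rpow (by fun_prop) (fun s => Or.inl hσ'.ne')
        fun_prop
      have := (hc.tendsto 0).mono_left (nhdsWithin_le_nhds (s := Ioi 0))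
      simpa using this
  have hval : ∀ᶠ s : ℝ in 𝓝[>] 0, (∫ σ in Ioi 0, ((σ ^ (-s) : ℝ) : ℂ) * k σ) =
      ((Real.Gamma (1 - s) * Real.Gamma (s / β + 1) * Real.sinc (π * s) : ℝ) : ℂ) *
        Complex.exp (-(Complex.I * (s * (γ / β)))) := by
    have : ∀ᶠ s : ℝ in 𝓝[>] 0, s ∈ Ioo (0:ℝ) (1/2) := Ioo_mem_nhdsGT (by norm_num)
    filter_upwards [this] with s hs
    have hs0 := hs.1
    obtain ⟨i1, v1⟩ := LW_mellin h0 (δ := -d) (by rwa [abs_neg]) hp hs.1 (by linarith [hs.2])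
    obtain ⟨i2, v2⟩ := LW_mellin h0 hd hm hs.1 (by linarith [hs.2])
    have e : ∀ σ ∈ Ioi (0:ℝ), ((σ ^ (-s) : ℝ) : ℂ) * k σ = -(1 / (2 * π * Complex.I)) *
        (((σ ^ (-s) : ℝ) : ℂ) * LW β (-d) (γ + (π - d) * β) σ -
          ((σ ^ (-s) : ℝ) : ℂ) * LW β d (γ - (π - d) * β) σ) := by
      intro σ hσ
      rw [hk, kW_eq h0 h1 hd hσ]; ring
    rw [setIntegral_congr_fun measurableSet_Ioi e, integral_const_mul, integral_sub i1 i2, v1, v2]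
    have hbc : (β : ℂ) ≠ 0 := by exact_mod_cast h0.ne'
    have hsc : (s : ℂ) ≠ 0 := by exact_mod_cast hs0.ne'
    have hpi : (π : ℂ) ≠ 0 := by exact_mod_cast Real.pi_ne_zero
    have x1 : Complex.exp (-(Complex.I * (s * (((γ + (π - d) * β : ℝ) : ℂ) / β - ((-d : ℝ) : ℂ))))) =
        Complex.exp (-(Complex.I * (s * (γ / β)))) * Complex.exp (-(π * s) * Complex.I) := by
      rw [← Complex.exp_add]; congr 1; push_cast; field_simp; ring
    have x2 : Complex.exp (-(Complex.I * (s * (((γ - (π - d) * β : ℝ) : ℂ) / β - d)))) =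
        Complex.exp (-(Complex.I * (s * (γ / β)))) * Complex.exp ((π * s) * Complex.I) := by
      rw [← Complex.exp_add]; congr 1; push_cast; field_simp; ring
    rw [x1, x2, Real.sinc_of_ne_zero (by positivity), Real.Gamma_add_one (by positivity)]
    push_cast
    rw [Complex.sin]
    have hI : Complex.I ≠ 0 := Complex.I_ne_zero
    field_simp
    rw [Complex.I_sq]; ring
  have hlim2 : Tendsto (fun s : ℝ =>
      ((Real.Gamma (1 - s) * Real.Gamma (s / β + 1) * Real.sinc (π * s) : ℝ) : ℂ) *
        Complex.exp (-(Complex.I * (s * (γ / β))))) (𝓝[>] 0) (𝓝 1) := by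
    have hc : ContinuousAt (fun s : ℝ =>
      ((Real.Gamma (1 - s) * Real.Gamma (s / β + 1) * Real.sinc (π * s) : ℝ) : ℂ) *
        Complex.exp (-(Complex.I * (s * (γ / β))))) 0 := by
      have hG : ContinuousAt Real.Gamma 1 :=
        (Real.differentiableAt_Gamma (fun m => by
          have : (0:ℝ) ≤ m := m.cast_nonneg
          linarith)).continuousAt
      have g1 : ContinuousAt (fun s : ℝ => Real.Gamma (1 - s)) 0 :=
        ContinuousAt.comp (g := Real.Gamma) (f := fun s : ℝ => 1 - s) (by simpa using hG)
          (by fun_prop)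
      have g2 : ContinuousAt (fun s : ℝ => Real.Gamma (s / β + 1)) 0 :=
        ContinuousAt.comp (g := Real.Gamma) (f := fun s : ℝ => s / β + 1) (by simpa using hG)
          (by fun_prop)
      have g3 : ContinuousAt (fun s : ℝ => Real.sinc (π * s)) 0 :=
        (Real.continuous_sinc.comp (by fun_prop : Continuous fun s : ℝ => π * s)).continuousAt
      have g4 := (g1.mul g2).mul g3
      have g5 : ContinuousAt (fun s : ℝ =>
        ((Real.Gamma (1 - s) * Real.Gamma (s / β + 1) * Real.sinc (π * s) : ℝ) : ℂ)) 0 :=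
        Complex.continuous_ofReal.continuousAt.comp g4
      exact g5.mul (by fun_prop)
    have := hc.tendsto.mono_left (nhdsWithin_le_nhds (s := Ioi 0))
    simpa using this
  exact tendsto_nhds_unique hlim (hlim2.congr' (hval.mono fun s h => h.symm))

lemma approx_id {k : ℝ → ℝ} (hk : IntegrableOn k (Ioi 0)) (hmeas : Measurable k)
    {τ : ℝ → ℝ} {t h : ℝ} (ht : 0 < t) (hth : t < h) (hτ : ContinuousOn τ (Icc 0 h)) :
    Tendsto (fun l : ℝ => ∫ η in (0:ℝ)..t, l⁻¹ * k ((t - η) / l) * τ η) (𝓝[>] 0)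
      (𝓝 ((∫ σ in Ioi 0, k σ) * τ t)) := by
  set T : ℝ → ℝ := (Icc 0 t).indicator τ with hT
  have hτt : ContinuousOn τ (Icc 0 t) := hτ.mono (Icc_subset_Icc_right hth.le)
  have hTm : Measurable T := by
    apply measurable_of_restrict_of_restrict_compl (s := Icc 0 t) measurableSet_Icc
    · have : (Icc 0 t).domRestrict T = (Icc 0 t).domRestrict τ := by
        funext x; exact Set.indicator_of_mem x.2 τ
      rw [this]
      exact hτt.domRestrict.measurable
    · have : (Icc 0 t)ᶜ.domRestrict T = fun _ => 0 := by
        funext x; exact Set.indicator_of_notMem x.2 τ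
      rw [this]; exact measurable_const
  obtain ⟨M, hM⟩ := isCompact_Icc.exists_bound_of_continuousOn hτt
  have hM0 : 0 ≤ M := (norm_nonneg _).trans (hM 0 ⟨le_rfl, ht.le⟩)
  have hTb : ∀ x, ‖T x‖ ≤ M := by
    intro x
    by_cases hx : x ∈ Icc 0 t
    · rw [hT, Set.indicator_of_mem hx]; exact hM x hx
    · rw [hT, Set.indicator_of_notMem hx]; simpa using hM0
  have hlim : Tendsto (fun l : ℝ => ∫ σ in Ioi 0, k σ * T (t - l * σ)) (𝓝[>] 0)
      (𝓝 (∫ σ in Ioi 0, k σ * τ t)) := by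
    refine tendsto_integral_filter_of_dominated_convergence (fun σ => ‖k σ‖ * M) ?_ ?_
      (hk.norm.mul_const M) ?_
    · filter_upwards with l
      apply Measurable.aestronglyMeasurable
      fun_prop
    · filter_upwards with l
      filter_upwards with σ
      rw [norm_mul]
      gcongr
      exact hTb _
    · filter_upwards [ae_restrict_mem measurableSet_Ioi] with σ hσ
      have hσ' : (0:ℝ) < σ := hσ
      apply Tendsto.const_mul
      have h1 : Tendsto (fun l : ℝ => t - l * σ) (𝓝[>] 0) (𝓝[Icc 0 t] t) := by
        apply tendsto_nhdsWithin_iff.2 ⟨?_, ?_⟩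
        · have hc : Continuous (fun l : ℝ => t - l * σ) := by fun_prop
          have := (hc.tendsto 0).mono_left (nhdsWithin_le_nhds (s := Ioi 0))
          simpa using this
        · have : ∀ᶠ l : ℝ in 𝓝[>] 0, l ∈ Ioo (0:ℝ) (t / σ) := Ioo_mem_nhdsGT (by positivity)
          filter_upwards [this] with l hl
          have := (lt_div_iff₀ hσ').1 hl.2
          have := mul_pos hl.1 hσ'
          constructor <;> linarith
      have h2 : Tendsto T (𝓝[Icc 0 t] t) (𝓝 (τ t)) := by
        have := hτt t ⟨ht.le, le_rfl⟩
        refine Tendsto.congr' ?_ this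
        filter_upwards [self_mem_nhdsWithin] with x hx
        rw [hT, Set.indicator_of_mem hx]
      exact h2.comp h1
  rw [integral_mul_const] at hlim
  refine hlim.congr' ?_
  filter_upwards [self_mem_nhdsWithin] with l hl
  have hl' : (0:ℝ) < l := hl
  have hsub := intervalIntegral.integral_comp_sub_div (a := 0) (b := t)
    (fun σ => l⁻¹ * k σ * τ (t - l * σ)) hl'.ne' (t / l)
  have e1 : ∀ η : ℝ, l⁻¹ * k (t / l - η / l) * τ (t - l * (t / l - η / l)) =
      l⁻¹ * k ((t - η) / l) * τ η := by
    intro η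
    rw [← sub_div, mul_div_cancel₀ _ hl'.ne', sub_sub_cancel]
  simp only [e1] at hsub
  rw [hsub, sub_self, zero_div, sub_zero, intervalIntegral.integral_of_le (by positivity),
    smul_eq_mul, ← integral_const_mul, ← integral_indicator measurableSet_Ioi,
    ← integral_indicator measurableSet_Ioc]
  congr 1
  funext σ
  by_cases h1 : σ ∈ Ioi (0:ℝ)
  · have h1' : (0:ℝ) < σ := h1
    rw [Set.indicator_of_mem h1]
    by_cases h2 : σ ≤ t / l
    · have h3 := (le_div_iff₀ hl').1 h2
      have h4 := mul_pos h1' hl'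
      rw [Set.indicator_of_mem (show σ ∈ Ioc 0 (t / l) from ⟨h1, h2⟩), hT,
        Set.indicator_of_mem (show t - l * σ ∈ Icc 0 t from ⟨by linarith, by linarith⟩)]
      field_simp
    · have h3 := (div_lt_iff₀ hl').1 (not_le.1 h2)
      rw [Set.indicator_of_notMem (show σ ∉ Ioc 0 (t / l) from fun h => h2 h.2), hT,
        Set.indicator_of_notMem (show t - l * σ ∉ Icc 0 t from fun h => by linarith [h.1]), mul_zero]
  · rw [Set.indicator_of_notMem h1,
      Set.indicator_of_notMem (show σ ∉ Ioc 0 (t / l) from fun h => h1 h.1)]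

lemma kW_scale {β : ℝ} (h0 : 0 < β) (c : ℂ) {X s : ℝ} (hX : 0 < X) (hs : 0 < s) :
    ((X ^ (1 / β) : ℝ) : ℂ)⁻¹ * kW β c (s / X ^ (1 / β)) =
      (s : ℂ)⁻¹ * fW β (c * ((X / s ^ β : ℝ) : ℂ)) := by
  unfold kW
  have hl : 0 < X ^ (1 / β) := Real.rpow_pos_of_pos hX _
  have e : (s / X ^ (1 / β)) ^ (-β) = X / s ^ β := by
    rw [Real.div_rpow hs.le hl.le, ← Real.rpow_mul hX.le, Real.rpow_neg hs.le,
      show 1 / β * -β = -1 by field_simp, Real.rpow_neg_one]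
    field_simp
  rw [e, ← mul_assoc]
  congr 1
  have h1 : ((X ^ (1 / β) : ℝ) : ℂ) ≠ 0 := by exact_mod_cast hl.ne'
  have h2 : (s : ℂ) ≠ 0 := by exact_mod_cast hs.ne'
  rw [Complex.ofReal_div]
  field_simp

lemma approx_final {β : ℝ} (h0 : 0 < β) {k : ℝ → ℝ} (hk : IntegrableOn k (Ioi 0))
    (hmeas : Measurable k) {τ : ℝ → ℝ} {t h a : ℝ} (ht : 0 < t) (hth : t < h)
    (hτ : ContinuousOn τ (Icc 0 h)) {l : Filter ℝ}
    (hl : Tendsto (fun x => |x - a|) l (𝓝[>] 0)) (D : ℝ → ℝ → ℝ) (q : ℝ)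
    (hD : ∀ᶠ x in l, ∀ s, 0 < s →
      D x s = q * ((|x - a| ^ (1 / β))⁻¹ * k (s / |x - a| ^ (1 / β)))) :
    Tendsto (fun x => ∫ η in (0:ℝ)..t, D x (t - η) * τ η) l
      (𝓝 (q * ((∫ σ in Ioi 0, k σ) * τ t))) := by
  have hl2 : Tendsto (fun x => |x - a| ^ (1 / β)) l (𝓝[>] 0) := by
    have : Tendsto (fun X : ℝ => X ^ (1 / β)) (𝓝[>] 0) (𝓝[>] 0) := by
      apply tendsto_nhdsWithin_iff.2 ⟨?_, ?_⟩
      · have hc : Continuous (fun X : ℝ => X ^ (1 / β)) :=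
          Real.continuous_rpow_const (by positivity)
        have := (hc.tendsto 0).mono_left (nhdsWithin_le_nhds (s := Ioi 0))
        rwa [Real.zero_rpow (by positivity)] at this
      · filter_upwards [self_mem_nhdsWithin] with X hX
        exact Real.rpow_pos_of_pos hX _
    exact this.comp hl
  refine (((approx_id hk hmeas ht hth hτ).comp hl2).const_mul q).congr' ?_
  filter_upwards [hD] with x hx
  simp only [Function.comp]
  rw [← intervalIntegral.integral_const_mul, intervalIntegral.integral_of_le ht.le,
    intervalIntegral.integral_of_le ht.le, integral_Ioc_eq_integral_Ioo,
    integral_Ioc_eq_integral_Ioo]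
  refine setIntegral_congr_fun measurableSet_Ioo (fun η hη => ?_)
  simp only [hx (t - η) (by linarith [hη.2])]
  ring

lemma wright_derivs {α : ℝ} (h0 : 0 < α) (h1 : α < 1) :
    ∃ Φ₁ : ℂ → ℂ, (∀ z, HasDerivAt (wrightPhi (-(α/3)) ((2*α/3 : ℝ) : ℂ)) (Φ₁ z) z) ∧
      ∀ z, HasDerivAt Φ₁ (fW (α/3) z) z := by
  have hs := fun (R : ℝ) (hR : 0 < R) =>
    bcf_summable (β := α/3) (by positivity) (by linarith) hR
  have hfac : ∀ n : ℕ, (n.factorial : ℂ) ≠ 0 := fun n => by exact_mod_cast n.factorial_ne_zero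
  have hn1 : ∀ n : ℕ, (n : ℂ) + 1 ≠ 0 := fun n => by exact_mod_cast n.succ_ne_zero
  obtain ⟨s1, d1⟩ := ps_deriv
    (a := fun n => 1 / ((n.factorial : ℂ) * Complex.Gamma (-(α/3) * n + α/3))) hs (fun n => by
      unfold bcf
      rw [Nat.factorial_succ]
      push_cast
      rw [show -((α:ℂ)/3) * (n + 1) + α/3 = -(α/3 * n) by ring]
      have := hfac n
      have := hn1 n
      rw [mul_assoc, one_div, one_div, mul_inv ((n:ℂ) + 1), ← mul_assoc, mul_inv_cancel₀ (hn1 n),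
        one_mul])
  obtain ⟨s2, d2⟩ := ps_deriv
    (a := fun n => 1 / ((n.factorial : ℂ) * Complex.Gamma (-(α/3) * n + ((2*α/3 : ℝ) : ℂ)))) s1
    (fun n => by
      rw [Nat.factorial_succ]
      push_cast
      rw [show -((α:ℂ)/3) * (n + 1) + 2*α/3 = -(α/3) * n + α/3 by ring]
      rw [mul_assoc, one_div, one_div, mul_inv ((n:ℂ) + 1), ← mul_assoc, mul_inv_cancel₀ (hn1 n),
        one_mul])
  refine ⟨_, fun z => ?_, fun z => d1 z⟩
  have e : wrightPhi (-(α/3)) ((2*α/3 : ℝ) : ℂ) = fun z => ∑' n : ℕ,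
      1 / ((n.factorial : ℂ) * Complex.Gamma (-(α/3) * n + ((2*α/3 : ℝ) : ℂ))) * z ^ n := by
    funext z
    unfold wrightPhi
    refine tsum_congr (fun n => ?_)
    ring
  rw [e]
  exact d2 z

lemma deriv2_re {α : ℝ} (h0 : 0 < α) (h1 : α < 1) (A B : ℂ) (x : ℝ) {f : ℝ → ℝ}
    (hf : ∀ᶠ y in 𝓝 x, f y = (A * wrightPhi (-(α/3)) ((2*α/3 : ℝ) : ℂ) (B * y)).re) :
    deriv (deriv f) x = (A * B ^ 2 * fW (α/3) (B * x)).re := by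
  obtain ⟨Φ₁, hd1, hd2⟩ := wright_derivs h0 h1
  have hB : ∀ z : ℂ, HasDerivAt (fun y : ℂ => B * y) B z := fun z => by
    have := (hasDerivAt_id z).const_mul B
    rw [mul_one] at this
    exact this
  have c1 : ∀ y : ℝ, HasDerivAt
      (fun y : ℝ => (A * wrightPhi (-(α/3)) ((2*α/3 : ℝ) : ℂ) (B * y)).re)
      (A * (Φ₁ (B * y) * B)).re y := fun y => by
    have : HasDerivAt (fun w : ℂ => A * wrightPhi (-(α/3)) ((2*α/3 : ℝ) : ℂ) (B * w))
      (A * (Φ₁ (B * y) * B)) (y : ℂ) :=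
      ((hd1 (B * y)).comp (y : ℂ) (hB y)).const_mul A
    exact this.real_of_complex
  have c2 : HasDerivAt (fun y : ℝ => (A * (Φ₁ (B * y) * B)).re)
      (A * (fW (α/3) (B * x) * B * B)).re x := by
    have : HasDerivAt (fun w : ℂ => A * (Φ₁ (B * w) * B))
      (A * (fW (α/3) (B * x) * B * B)) (x : ℂ) :=
      (((hd2 (B * x)).comp (x : ℂ) (hB x)).mul_const B).const_mul A
    exact this.real_of_complex
  have e1 : deriv f =ᶠ[𝓝 x] fun y : ℝ => (A * (Φ₁ (B * y) * B)).re := by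
    have : f =ᶠ[𝓝 x] fun y : ℝ =>
      (A * wrightPhi (-(α/3)) ((2*α/3 : ℝ) : ℂ) (B * y)).re := hf
    refine this.deriv.trans ?_
    filter_upwards with y
    exact (c1 y).deriv
  rw [e1.deriv_eq, c2.deriv]
  congr 1
  ring

lemma e23_eq : e23 = -Complex.exp (Complex.I * ((-(π/3) : ℝ) : ℂ)) := by
  have : -Complex.exp (Complex.I * ((-(π/3) : ℝ) : ℂ)) =
      Complex.exp (π * Complex.I) * Complex.exp (Complex.I * ((-(π/3) : ℝ) : ℂ)) := by
    rw [Complex.exp_pi_mul_I]; ring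
  rw [this, ← Complex.exp_add]
  unfold e23
  congr 1
  push_cast
  ring

lemma e23_cube : e23 ^ 3 = 1 := by
  unfold e23
  rw [← Complex.exp_nat_mul]
  rw [show ((3:ℕ) : ℂ) * (2 * π * Complex.I / 3) = 2 * π * Complex.I by push_cast; ring]
  exact Complex.exp_two_pi_mul_I

lemma pow_aux {α s : ℝ} (hs : 0 < s) :
    s ^ (2*α/3 - 1) * (1 / s ^ (α/3)) ^ 2 = s⁻¹ := by
  have h2 : (s ^ (α/3)) ^ 2 = s ^ (2*α/3) := by
    rw [← Real.rpow_natCast, ← Real.rpow_mul hs.le]; congr 1; push_cast; ring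
  have : 0 < s ^ (2*α/3) := Real.rpow_pos_of_pos hs _
  rw [Real.rpow_sub_one hs.ne', one_div, inv_pow, h2]
  field_simp

/-- common computation for the three kernels -/
lemma kernel_eval {α : ℝ} (h0 : 0 < α) (h1 : α < 1) (A c c' : ℂ) {x s : ℝ} (hs : 0 < s)
    (hx : x ≠ 0) (q : ℝ) (hε : (x : ℂ) * c = |x| * c') (hA : A * c ^ 2 = q) {p : ℂ} {f : ℝ → ℝ}
    (hf : ∀ᶠ y in 𝓝 x, f y = ((s ^ (2*α/3 - 1) : ℝ) * (p * A) *
      wrightPhi (-(α/3)) ((2*α/3 : ℝ) : ℂ) (c * ((y / s ^ (α/3) : ℝ) : ℂ))).re) :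
    deriv (deriv f) x = q * ((|x| ^ (1 / (α/3)))⁻¹ *
      (p * kW (α/3) c' (s / |x| ^ (1 / (α/3)))).re) := by
  have hX : 0 < |x| := abs_pos.2 hx
  rw [deriv2_re h0 h1 ((s ^ (2*α/3 - 1) : ℝ) * (p * A)) (c * ((1 / s ^ (α/3) : ℝ) : ℂ)) x]
  · have hsc := kW_scale (β := α/3) (by positivity) c' hX hs
    rw [show q * ((|x| ^ (1 / (α/3)))⁻¹ * (p * kW (α/3) c' (s / |x| ^ (1 / (α/3)))).re) =
      ((q : ℂ) * p * (((|x| ^ (1 / (α/3)) : ℝ) : ℂ)⁻¹ * kW (α/3) c' (s / |x| ^ (1 / (α/3))))).re by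
        rw [← Complex.ofReal_inv, mul_assoc, Complex.re_ofReal_mul, mul_left_comm p,
          Complex.re_ofReal_mul], hsc]
    congr 1
    have e1 : c * ((1 / s ^ (α/3) : ℝ) : ℂ) * x = c' * ((|x| / s ^ (α/3) : ℝ) : ℂ) := by
      push_cast
      linear_combination (1 / ((s ^ (α/3) : ℝ) : ℂ)) * hε
    rw [e1, mul_pow]
    have e2 : ((s ^ (2*α/3 - 1) : ℝ) : ℂ) * ((1 / s ^ (α/3) : ℝ) : ℂ) ^ 2 = (s : ℂ)⁻¹ := by
      rw [← Complex.ofReal_inv, ← pow_aux (α := α) hs]; push_cast; rfl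
    rw [← e2, ← hA]
    ring
  · filter_upwards [hf] with y hy
    rw [hy]
    congr 3
    push_cast
    ring

lemma k_re {β : ℝ} (h0 : 0 < β) (h1 : β < 1) {d γ : ℝ} (hd : |d| < π / 2)
    (hp : |γ + (π - d) * β| < π / 2) (hm : |γ - (π - d) * β| < π / 2) (p c : ℂ)
    (hc : c = -Complex.exp (Complex.I * γ)) :
    IntegrableOn (fun σ => (p * kW β c σ).re) (Ioi 0) ∧ Measurable (fun σ => (p * kW β c σ).re) ∧
    ∫ σ in Ioi 0, (p * kW β c σ).re = p.re := by
  obtain ⟨i, v⟩ := kW_total h0 h1 hd hp hm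
  rw [← hc] at i v
  have hi : Integrable (fun σ => p * kW β c σ) (volume.restrict (Ioi 0)) := i.const_mul p
  refine ⟨hi.re, ?_, ?_⟩
  · exact Complex.measurable_re.comp ((kW_meas h0 h1 c).const_mul p)
  · have h := integral_re hi
    rw [integral_const_mul, v, mul_one] at h
    exact h


/-- **Lemma 2.** Jump relations for the potentials built with the second spatial
derivatives of the fundamental solutions and Hölder continuous densities:
`w₃(x,t) = ∫₀ᵗ ∂²_x G_α^{2α/3}(x−a, t−η) τ₃(η) dη` satisfies
`w₃(a−0,t) = τ₃(t)/3`, `w₃(a+0,t) = −2τ₃(t)/3`, and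
`w₄(x,t) = ∫₀ᵗ ∂²_x V_α^{2α/3}(x−a, t−η) τ₄(η) dη` satisfies `w₄(a+0,t) = 0`. -/
theorem potentials_w3_w4_jump_relations
    (α : ℝ) (hα0 : 0 < α) (hα1 : α < 1) (a h : ℝ) (hh : 0 < h) (τ₃ τ₄ : ℝ → ℝ)
    (hτ₃ : ∃ C r : NNReal, 0 < r ∧ HolderOnWith C r τ₃ (Set.Icc 0 h))
    (hτ₄ : ∃ C r : NNReal, 0 < r ∧ HolderOnWith C r τ₄ (Set.Icc 0 h))
    (w₃ w₄ : ℝ → ℝ → ℝ)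
    (hw₃ : ∀ x t, w₃ x t =
      ∫ η in (0:ℝ)..t, deriv (deriv (fun y => Gfun α (2*α/3) y (t - η))) (x - a) * τ₃ η)
    (hw₄ : ∀ x t, w₄ x t =
      ∫ η in (0:ℝ)..t, deriv (deriv (fun y => Vfun α (2*α/3) y (t - η))) (x - a) * τ₄ η) :
    ∀ t, 0 < t → t < h →
      Filter.Tendsto (fun x => w₃ x t) (nhdsWithin a (Set.Iio a)) (nhds ((1/3) * τ₃ t)) ∧
      Filter.Tendsto (fun x => w₃ x t) (nhdsWithin a (Set.Ioi a)) (nhds (-(2/3) * τ₃ t)) ∧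
      Filter.Tendsto (fun x => w₄ x t) (nhdsWithin a (Set.Ioi a)) (nhds 0) := by
  intro t ht hth
  have hβ0 : 0 < α / 3 := by positivity
  have hβ1 : α / 3 < 1 := by linarith
  have hc₃ : ContinuousOn τ₃ (Icc 0 h) := by
    obtain ⟨C, r, hr, hH⟩ := hτ₃
    exact hH.continuousOn hr
  have hc₄ : ContinuousOn τ₄ (Icc 0 h) := by
    obtain ⟨C, r, hr, hH⟩ := hτ₄
    exact hH.continuousOn hr
  have hpi := Real.pi_pos
  obtain ⟨ψ, hψ1, hψ2⟩ : ∃ ψ, π / 2 < ψ ∧ ψ < min π (π / (6 * (α / 3))) := by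
    apply exists_between
    apply lt_min (by linarith)
    rw [lt_div_iff₀ (by positivity)]
    nlinarith
  have hψ3 : ψ < π := hψ2.trans_le (min_le_left _ _)
  have hψ4 : ψ * (α / 3) < π / 6 := by
    have := (lt_div_iff₀ (by positivity)).1 (hψ2.trans_le (min_le_right _ _))
    linarith
  have hψ5 : 0 < ψ * (α / 3) := mul_pos (by linarith) hβ0
  have hd : |π - ψ| < π / 2 := by rw [abs_lt]; constructor <;> linarith
  have K1 := fun p : ℂ => k_re hβ0 hβ1 (γ := 0) hd
    (by rw [sub_sub_cancel, abs_lt]; constructor <;> linarith)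
    (by rw [sub_sub_cancel, abs_lt]; constructor <;> linarith) p (-1) (by simp)
  have K2 := fun p : ℂ => k_re hβ0 hβ1 (γ := -(π/3)) hd
    (by rw [sub_sub_cancel, abs_lt]; constructor <;> linarith)
    (by rw [sub_sub_cancel, abs_lt]; constructor <;> linarith) p e23 e23_eq
  have habs : Tendsto (fun x => |x - a|) (𝓝 a) (𝓝 0) := by
    have hc : Continuous (fun x => |x - a|) := by fun_prop
    simpa using hc.tendsto a
  have hl1 : Tendsto (fun x => |x - a|) (𝓝[<] a) (𝓝[>] 0) := by
    refine tendsto_nhdsWithin_iff.2 ⟨habs.mono_left nhdsWithin_le_nhds, ?_⟩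
    filter_upwards [self_mem_nhdsWithin] with x hx
    exact abs_pos.2 (sub_ne_zero.2 (mem_Iio.1 hx).ne)
  have hl2 : Tendsto (fun x => |x - a|) (𝓝[>] a) (𝓝[>] 0) := by
    refine tendsto_nhdsWithin_iff.2 ⟨habs.mono_left nhdsWithin_le_nhds, ?_⟩
    filter_upwards [self_mem_nhdsWithin] with x hx
    exact abs_pos.2 (sub_ne_zero.2 (mem_Ioi.1 hx).ne')
  simp only [hw₃, hw₄]
  refine ⟨?_, ?_, ?_⟩
  · obtain ⟨i, m, v⟩ := K1 1
    have := approx_final hβ0 i m ht hth hc₃ hl1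
      (fun x s => deriv (deriv (fun y => Gfun α (2*α/3) y s)) (x - a)) (1/3) ?_
    · rw [v] at this
      simpa using this
    · filter_upwards [self_mem_nhdsWithin] with x hx s hs
      have hx' : x - a < 0 := sub_neg.2 hx
      refine kernel_eval hα0 hα1 (1/3) 1 (-1) hs hx'.ne (1/3) ?_ ?_ ?_
      · rw [abs_of_neg hx']; push_cast; ring
      · push_cast; ring
      · filter_upwards [Iio_mem_nhds hx'] with y hy
        unfold Gfun
        rw [if_pos (mem_Iio.1 hy), one_mul, one_mul, mul_comm (1/3 : ℝ), ← Complex.re_ofReal_mul]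
        push_cast
        rfl
  · obtain ⟨i, m, v⟩ := K2 1
    have := approx_final hβ0 i m ht hth hc₃ hl2
      (fun x s => deriv (deriv (fun y => Gfun α (2*α/3) y s)) (x - a)) (-(2/3)) ?_
    · rw [v] at this
      simpa using this
    · filter_upwards [self_mem_nhdsWithin] with x hx s hs
      have hx' : 0 < x - a := sub_pos.2 hx
      refine kernel_eval hα0 hα1 (-(2/3) * e23) e23 e23 hs hx'.ne' (-(2/3)) ?_ ?_ ?_
      · rw [abs_of_pos hx']
      · push_cast; linear_combination (-(2/3)) * e23_cube
      · filter_upwards [Ioi_mem_nhds hx'] with y hy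
        unfold Gfun
        rw [if_neg (not_lt.2 (le_of_lt (mem_Ioi.1 hy))), one_mul, mul_comm (-(2/3) : ℝ),
          ← Complex.re_ofReal_mul]
        congr 1
        push_cast
        ring
  · obtain ⟨i, m, v⟩ := K2 (-Complex.I)
    have := approx_final hβ0 i m ht hth hc₄ hl2
      (fun x s => deriv (deriv (fun y => Vfun α (2*α/3) y s)) (x - a)) (1/3) ?_
    · rw [v] at this
      simpa using this
    · filter_upwards [self_mem_nhdsWithin] with x hx s hs
      have hx' : 0 < x - a := sub_pos.2 hx
      refine kernel_eval hα0 hα1 (1/3 * e23) e23 e23 hs hx'.ne' (1/3) ?_ ?_ ?_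
      · rw [abs_of_pos hx']
      · push_cast; linear_combination (1/3) * e23_cube
      · filter_upwards with y
        unfold Vfun
        have him : ∀ z : ℂ, z.im = (-Complex.I * z).re := fun z => by simp
        rw [him, mul_comm (1/3 : ℝ), ← Complex.re_ofReal_mul]
        congr 1
        push_cast
        ring
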